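/- (Adequacy) Let R be a polarized rewrite system such that the relations →₋ and →₊ commute and that has a pre-model of R. Let π be a proof-term of Γ ⊢_R A in polarized natural deduction modulo R and let σ be a substitution mapping each proof variable declared of type B in Γ to an element of |B|. Then the proof-term σπ is an element of |A|. -/

import Mathlib

/-- Propositional formulas: atoms (indexed by naturals), ⊥, ⇒, ∧, ∨. -/
inductive Form : Type where
  | atom : ℕ → Form
  | bot  : Form
  | imp  : Form → Form → Form
  | and  : Form → Form → Form
  | or   : Form → Form → Form

/-- A polarized rewrite system: a set of negative rules and a set of positive
rules, each rewriting an atomic proposition to an arbitrary formula. -/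
structure PRS : Type where
  neg : ℕ → Form → Prop
  pos : ℕ → Form → Prop

mutual
  /-- One step negative rewriting →₋¹. -/
  inductive Neg1 (R : PRS) : Form → Form → Prop where
    | rule {P A} : R.neg P A → Neg1 R (.atom P) A
    | impL {A A' B} : Pos1 R A A' → Neg1 R (.imp A B) (.imp A' B)
    | impR {A B B'} : Neg1 R B B' → Neg1 R (.imp A B) (.imp A B')
    | andL {A A' B} : Neg1 R A A' → Neg1 R (.and A B) (.and A' B)
    | andR {A B B'} : Neg1 R B B' → Neg1 R (.and A B) (.and A B')
    | orL  {A A' B} : Neg1 R A A' → Neg1 R (.or A B) (.or A' B)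
    | orR  {A B B'} : Neg1 R B B' → Neg1 R (.or A B) (.or A B')
  /-- One step positive rewriting →₊¹. -/
  inductive Pos1 (R : PRS) : Form → Form → Prop where
    | rule {P A} : R.pos P A → Pos1 R (.atom P) A
    | impL {A A' B} : Neg1 R A A' → Pos1 R (.imp A B) (.imp A' B)
    | impR {A B B'} : Pos1 R B B' → Pos1 R (.imp A B) (.imp A B')
    | andL {A A' B} : Pos1 R A A' → Pos1 R (.and A B) (.and A' B)
    | andR {A B B'} : Pos1 R B B' → Pos1 R (.and A B) (.and A B')
    | orL  {A A' B} : Pos1 R A A' → Pos1 R (.or A B) (.or A' B)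
    | orR  {A B B'} : Pos1 R B B' → Pos1 R (.or A B) (.or A B')
end

/-- →₋ : reflexive-transitive closure of →₋¹. -/
def NegR (R : PRS) : Form → Form → Prop := Relation.ReflTransGen (Neg1 R)

/-- →₊ : reflexive-transitive closure of →₊¹. -/
def PosR (R : PRS) : Form → Form → Prop := Relation.ReflTransGen (Pos1 R)

/-- The relations →₋ and →₊ commute. -/
def Commutes (R : PRS) : Prop :=
  ∀ A B C, NegR R B A → PosR R B C → ∃ D, PosR R A D ∧ NegR R C D

/-- Proof-terms (de Bruijn representation of the proof variables). -/
inductive PTerm : Type where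
  | var  : ℕ → PTerm
  | lam  : PTerm → PTerm
  | app  : PTerm → PTerm → PTerm
  | pair : PTerm → PTerm → PTerm
  | fst  : PTerm → PTerm
  | snd  : PTerm → PTerm
  | inl  : PTerm → PTerm
  | inr  : PTerm → PTerm
  | case : PTerm → PTerm → PTerm → PTerm
  | exf  : PTerm → PTerm

/-- Shift by one all de Bruijn indices ≥ c. -/
def liftAbove (c : ℕ) : PTerm → PTerm
  | .var n => if n < c then .var n else .var (n+1)
  | .lam π => .lam (liftAbove (c+1) π)
  | .app a b => .app (liftAbove c a) (liftAbove c b)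
  | .pair a b => .pair (liftAbove c a) (liftAbove c b)
  | .fst a => .fst (liftAbove c a)
  | .snd a => .snd (liftAbove c a)
  | .inl a => .inl (liftAbove c a)
  | .inr a => .inr (liftAbove c a)
  | .case a b c' => .case (liftAbove c a) (liftAbove (c+1) b) (liftAbove (c+1) c')
  | .exf a => .exf (liftAbove c a)

/-- Substitution [u/k]π of the term u for the variable k. -/
def subst (k : ℕ) (u : PTerm) : PTerm → PTerm
  | .var n => if n < k then .var n else if n = k then u else .var (n-1)
  | .lam π => .lam (subst (k+1) (liftAbove 0 u) π)
  | .app a b => .app (subst k u a) (subst k u b)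
  | .pair a b => .pair (subst k u a) (subst k u b)
  | .fst a => .fst (subst k u a)
  | .snd a => .snd (subst k u a)
  | .inl a => .inl (subst k u a)
  | .inr a => .inr (subst k u a)
  | .case a b c => .case (subst k u a) (subst (k+1) (liftAbove 0 u) b) (subst (k+1) (liftAbove 0 u) c)
  | .exf a => .exf (subst k u a)

/-- Typing judgement of polarized natural deduction modulo R:
`Typed R Γ π A` means "π is a proof-term of Γ ⊢_R A".
A context is a finite list of formulas (the declaration of variable n is the
n-th entry of the list). -/
inductive Typed (R : PRS) : List Form → PTerm → Form → Prop where
  | ax {Γ n A B C} : Γ[n]? = some A → NegR R A C → PosR R B C →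
      Typed R Γ (.var n) B
  | impI {Γ π A B C} : Typed R (A :: Γ) π B → PosR R C (.imp A B) →
      Typed R Γ (.lam π) C
  | impE {Γ π₁ π₂ A B C} : Typed R Γ π₁ C → NegR R C (.imp A B) →
      Typed R Γ π₂ A → Typed R Γ (.app π₁ π₂) B
  | andI {Γ π₁ π₂ A B C} : Typed R Γ π₁ A → Typed R Γ π₂ B →
      PosR R C (.and A B) → Typed R Γ (.pair π₁ π₂) C
  | andE₁ {Γ π A B C} : Typed R Γ π C → NegR R C (.and A B) →
      Typed R Γ (.fst π) A
  | andE₂ {Γ π A B C} : Typed R Γ π C → NegR R C (.and A B) →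
      Typed R Γ (.snd π) B
  | orI₁ {Γ π A B C} : Typed R Γ π A → PosR R C (.or A B) →
      Typed R Γ (.inl π) C
  | orI₂ {Γ π A B C} : Typed R Γ π B → PosR R C (.or A B) →
      Typed R Γ (.inr π) C
  | orE {Γ π₁ π₂ π₃ A B C D} : Typed R Γ π₁ D → NegR R D (.or A B) →
      Typed R (A :: Γ) π₂ C → Typed R (B :: Γ) π₃ C →
      Typed R Γ (.case π₁ π₂ π₃) C
  | botE {Γ π A B} : Typed R Γ π B → NegR R B .bot →
      Typed R Γ (.exf π) A

/-- One step proof reduction ▷¹ (contextual closure of the cut elimination rules). -/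
inductive Red1 : PTerm → PTerm → Prop where
  | beta {π₁ π₂} : Red1 (.app (.lam π₁) π₂) (subst 0 π₂ π₁)
  | fstPair {π₁ π₂} : Red1 (.fst (.pair π₁ π₂)) π₁
  | sndPair {π₁ π₂} : Red1 (.snd (.pair π₁ π₂)) π₂
  | caseInl {π₁ π₂ π₃} : Red1 (.case (.inl π₁) π₂ π₃) (subst 0 π₁ π₂)
  | caseInr {π₁ π₂ π₃} : Red1 (.case (.inr π₁) π₂ π₃) (subst 0 π₁ π₃)
  | lam {π π'} : Red1 π π' → Red1 (.lam π) (.lam π')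
  | appL {π π' ρ} : Red1 π π' → Red1 (.app π ρ) (.app π' ρ)
  | appR {π ρ ρ'} : Red1 ρ ρ' → Red1 (.app π ρ) (.app π ρ')
  | pairL {π π' ρ} : Red1 π π' → Red1 (.pair π ρ) (.pair π' ρ)
  | pairR {π ρ ρ'} : Red1 ρ ρ' → Red1 (.pair π ρ) (.pair π ρ')
  | fst {π π'} : Red1 π π' → Red1 (.fst π) (.fst π')
  | snd {π π'} : Red1 π π' → Red1 (.snd π) (.snd π')
  | inl {π π'} : Red1 π π' → Red1 (.inl π) (.inl π')
  | inr {π π'} : Red1 π π' → Red1 (.inr π) (.inr π')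
  | case₁ {π π' ρ τ} : Red1 π π' → Red1 (.case π ρ τ) (.case π' ρ τ)
  | case₂ {π ρ ρ' τ} : Red1 ρ ρ' → Red1 (.case π ρ τ) (.case π ρ' τ)
  | case₃ {π ρ τ τ'} : Red1 τ τ' → Red1 (.case π ρ τ) (.case π ρ τ')
  | exf {π π'} : Red1 π π' → Red1 (.exf π) (.exf π')

/-- ▷ : reflexive-transitive closure of ▷¹. -/
def Red : PTerm → PTerm → Prop := Relation.ReflTransGen Red1

/-- A proof-term is strongly normalizable if every ▷¹-reduction sequence from
it is finite, i.e. it is accessible for the inverse of ▷¹. -/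
def SN (π : PTerm) : Prop := Acc (fun x y => Red1 y x) π

/-- Neutral proof-terms: variables and eliminations, not introductions. -/
def Neutral : PTerm → Prop
  | .var _ => True
  | .app _ _ => True
  | .fst _ => True
  | .snd _ => True
  | .case _ _ _ => True
  | .exf _ => True
  | _ => False

/-- Reducibility candidates. -/
structure IsCandidate (S : Set PTerm) : Prop where
  sn : ∀ π ∈ S, SN π
  closed : ∀ π ∈ S, ∀ π', Red π π' → π' ∈ S
  neutral : ∀ π, Neutral π → (∀ π', Red1 π π' → π' ∈ S) → π ∈ S

/-- A pre-model is an assignment of a reducibility candidate to each atom. -/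
def IsPreModel (M : ℕ → Set PTerm) : Prop := ∀ P, IsCandidate (M P)

/-- The interpretation |A| of a formula in a pre-model. -/
def interp (M : ℕ → Set PTerm) : Form → Set PTerm
  | .atom P => M P
  | .bot => {π | SN π}
  | .imp A B => {π | SN π ∧ ∀ π₁, Red π (.lam π₁) →
      ∀ π' ∈ interp M A, subst 0 π' π₁ ∈ interp M B}
  | .and A B => {π | SN π ∧ ∀ π₁ π₂, Red π (.pair π₁ π₂) →
      π₁ ∈ interp M A ∧ π₂ ∈ interp M B}
  | .or A B => {π | SN π ∧ (∀ π₁, Red π (.inl π₁) → π₁ ∈ interp M A) ∧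
      (∀ π₂, Red π (.inr π₂) → π₂ ∈ interp M B)}

/-- A pre-model of a polarized rewrite system R. -/
def IsPreModelOf (R : PRS) (M : ℕ → Set PTerm) : Prop :=
  IsPreModel M ∧
  (∀ P A, R.neg P A → interp M (.atom P) ⊆ interp M A) ∧
  (∀ P A, R.pos P A → interp M A ⊆ interp M (.atom P))

/-- Lift a substitution under a binder. -/
def liftSub (σ : ℕ → PTerm) : ℕ → PTerm
  | 0 => .var 0
  | n+1 => liftAbove 0 (σ n)

/-- Simultaneous substitution σπ of a substitution σ in a proof-term π. -/
def msubst (σ : ℕ → PTerm) : PTerm → PTerm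
  | .var n => σ n
  | .lam π => .lam (msubst (liftSub σ) π)
  | .app a b => .app (msubst σ a) (msubst σ b)
  | .pair a b => .pair (msubst σ a) (msubst σ b)
  | .fst a => .fst (msubst σ a)
  | .snd a => .snd (msubst σ a)
  | .inl a => .inl (msubst σ a)
  | .inr a => .inr (msubst σ a)
  | .case a b c => .case (msubst σ a) (msubst (liftSub σ) b) (msubst (liftSub σ) c)
  | .exf a => .exf (msubst σ a)

/-- Lifting of a renaming under a binder. -/
def liftRen (ρ : ℕ → ℕ) : ℕ → ℕ
  | 0 => 0
  | n + 1 => ρ n + 1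

/-- The substitution mapping the variable `0` to `u` and `n + 1` to `σ n`. -/
def scons (u : PTerm) (σ : ℕ → PTerm) : ℕ → PTerm
  | 0 => u
  | n + 1 => σ n

theorem liftAbove_eq_msubst (c : ℕ) (t : PTerm) :
    liftAbove c t = msubst (fun n => .var (if n < c then n else n + 1)) t := by
  have key (c : ℕ) : liftSub (fun n => .var (if n < c then n else n + 1)) =
      fun n => .var (if n < c + 1 then n else n + 1) := by
    funext n
    cases n with
    | zero => simp [liftSub]
    | succ n => simp only [liftSub, liftAbove]; split_ifs <;> grind
  induction t generalizing c with
  | var n => simp only [liftAbove, msubst]; split_ifs <;> rfl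
  | _ => simp_all [liftAbove, msubst]

theorem liftAbove_zero_eq_msubst (t : PTerm) :
    liftAbove 0 t = msubst (fun n => .var (n + 1)) t := by
  simpa using liftAbove_eq_msubst 0 t

theorem subst_eq_msubst (k : ℕ) (u t : PTerm) :
    subst k u t = msubst (fun n => subst k u (.var n)) t := by
  have key (k : ℕ) (u : PTerm) : liftSub (fun n => subst k u (.var n)) =
      fun n => subst (k + 1) (liftAbove 0 u) (.var n) := by
    funext n
    cases n with
    | zero => simp [liftSub, subst]
    | succ n => simp only [liftSub, subst]; split_ifs <;> grind [liftAbove]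
  induction t generalizing k u with
  | var n => rfl
  | lam t ih => rw [subst, msubst, key, ← ih]
  | case a b c iha ihb ihc => rw [subst, msubst, key, ← iha, ← ihb, ← ihc]
  | _ => rw [subst, msubst]; congr 1 <;> apply_assumption

theorem subst_zero_eq_msubst (u t : PTerm) : subst 0 u t = msubst (scons u .var) t := by
  rw [subst_eq_msubst]
  congr 1
  funext n
  cases n <;> simp [subst, scons]

theorem liftSub_var_comp (ρ : ℕ → ℕ) :
    liftSub (fun n => .var (ρ n)) = fun n => .var (liftRen ρ n) := by
  funext n
  cases n <;> simp [liftSub, liftRen, liftAbove]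

theorem msubst_rename (σ : ℕ → PTerm) (ρ : ℕ → ℕ) (t : PTerm) :
    msubst σ (msubst (fun n => .var (ρ n)) t) = msubst (fun n => σ (ρ n)) t := by
  have key (σ : ℕ → PTerm) (ρ : ℕ → ℕ) :
      (fun n => liftSub σ (liftRen ρ n)) = liftSub (fun n => σ (ρ n)) := by
    funext n
    cases n <;> rfl
  induction t generalizing σ ρ with
  | var n => rfl
  | _ => simp_all [msubst, liftSub_var_comp]

theorem rename_msubst (ρ : ℕ → ℕ) (σ : ℕ → PTerm) (t : PTerm) :
    msubst (fun n => .var (ρ n)) (msubst σ t) =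
      msubst (fun n => msubst (fun m => .var (ρ m)) (σ n)) t := by
  have key (ρ : ℕ → ℕ) (σ : ℕ → PTerm) :
      (fun n => msubst (fun m => .var (liftRen ρ m)) (liftSub σ n)) =
        liftSub (fun n => msubst (fun m => .var (ρ m)) (σ n)) := by
    funext n
    cases n with
    | zero => rfl
    | succ n => simp only [liftSub, liftAbove_zero_eq_msubst, msubst_rename, liftRen]
  induction t generalizing σ ρ with
  | var n => rfl
  | _ => simp_all [msubst, liftSub_var_comp]

theorem msubst_msubst (σ τ : ℕ → PTerm) (t : PTerm) :
    msubst σ (msubst τ t) = msubst (fun n => msubst σ (τ n)) t := by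
  have key (σ τ : ℕ → PTerm) :
      (fun n => msubst (liftSub σ) (liftSub τ n)) = liftSub (fun n => msubst σ (τ n)) := by
    funext n
    cases n with
    | zero => rfl
    | succ n =>
      simp only [liftSub, liftAbove_zero_eq_msubst, msubst_rename]
      exact (rename_msubst Nat.succ σ (τ n)).symm
  induction t generalizing σ τ with
  | var n => rfl
  | _ => simp_all [msubst]

theorem msubst_var (t : PTerm) : msubst .var t = t := by
  have key : liftSub .var = .var := by
    funext n
    cases n <;> simp [liftSub, liftAbove]
  induction t with
  | var n => rfl
  | _ => simp_all [msubst]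

theorem subst_zero_msubst_liftSub (σ : ℕ → PTerm) (u t : PTerm) :
    subst 0 u (msubst (liftSub σ) t) = msubst (scons u σ) t := by
  rw [subst_zero_eq_msubst, msubst_msubst]
  congr 1
  funext n
  cases n with
  | zero => rfl
  | succ n =>
    simp only [liftSub, liftAbove_zero_eq_msubst, msubst_rename, scons]
    exact msubst_var _

theorem msubst_subst_zero (σ : ℕ → PTerm) (u t : PTerm) :
    msubst σ (subst 0 u t) = subst 0 (msubst σ u) (msubst (liftSub σ) t) := by
  rw [subst_zero_msubst_liftSub, subst_zero_eq_msubst, msubst_msubst]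
  congr 1
  funext n
  cases n <;> rfl

theorem Red1.msubst {t t' : PTerm} (h : Red1 t t') (σ : ℕ → PTerm) :
    Red1 (msubst σ t) (msubst σ t') := by
  induction h generalizing σ with
  | beta => rw [msubst_subst_zero]; exact .beta
  | caseInl => rw [msubst_subst_zero]; exact .caseInl
  | caseInr => rw [msubst_subst_zero]; exact .caseInr
  | _ => constructor <;> apply_assumption

theorem Red1.subst {t t' : PTerm} (h : Red1 t t') (u : PTerm) :
    Red1 (subst 0 u t) (subst 0 u t') := by
  simpa only [subst_zero_eq_msubst] using h.msubst _

theorem Red.subst {t t' : PTerm} (h : Red t t') (u : PTerm) :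
    Red (subst 0 u t) (subst 0 u t') := by
  induction h with
  | refl => exact .refl
  | tail _ hr ih => exact ih.tail (hr.subst u)

theorem SN.step {t t' : PTerm} (h : SN t) (hr : Red1 t t') : SN t' :=
  Acc.inv h hr

theorem SN.red {t t' : PTerm} (h : SN t) (hr : Red t t') : SN t' := by
  induction hr with
  | refl => exact h
  | tail _ hr ih => exact ih.step hr

/-- Strong normalization is reflected by maps preserving reduction steps. -/
theorem SN.of_map {f : PTerm → PTerm} (hf : ∀ t t', Red1 t t' → Red1 (f t) (f t'))
    {t : PTerm} (h : SN (f t)) : SN t :=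
  Subrelation.accessible (fun hr => hf _ _ hr) (InvImage.accessible f h)

theorem SN.of_subst {t u : PTerm} (h : SN (subst 0 u t)) : SN t :=
  .of_map (fun _ _ hr => hr.subst u) h

theorem SN.lam {t : PTerm} (h : SN t) : SN (.lam t) := by
  induction h with
  | intro t _ ih => exact ⟨_, fun _ hr => by cases hr with | lam hr => exact ih _ hr⟩

theorem SN.inl {t : PTerm} (h : SN t) : SN (.inl t) := by
  induction h with
  | intro t _ ih => exact ⟨_, fun _ hr => by cases hr with | inl hr => exact ih _ hr⟩

theorem SN.inr {t : PTerm} (h : SN t) : SN (.inr t) := by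
  induction h with
  | intro t _ ih => exact ⟨_, fun _ hr => by cases hr with | inr hr => exact ih _ hr⟩

theorem SN.exf {t : PTerm} (h : SN t) : SN (.exf t) := by
  induction h with
  | intro t _ ih => exact ⟨_, fun _ hr => by cases hr with | exf hr => exact ih _ hr⟩

theorem SN.pair {t u : PTerm} (ht : SN t) (hu : SN u) : SN (.pair t u) := by
  induction ht generalizing u with
  | intro t ht iht =>
    induction hu with
    | intro u hu ihu =>
      refine ⟨_, fun _ hr => ?_⟩
      cases hr with
      | pairL hr => exact iht _ hr ⟨_, hu⟩
      | pairR hr => exact ihu _ hr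

theorem Red.lam_inv {t s : PTerm} (h : Red (.lam t) s) : ∃ t', s = .lam t' ∧ Red t t' := by
  induction h with
  | refl => exact ⟨_, rfl, .refl⟩
  | tail _ hr ih =>
    obtain ⟨t', rfl, ht⟩ := ih
    cases hr with
    | lam hr => exact ⟨_, rfl, ht.tail hr⟩

theorem Red.inl_inv {t s : PTerm} (h : Red (.inl t) s) : ∃ t', s = .inl t' ∧ Red t t' := by
  induction h with
  | refl => exact ⟨_, rfl, .refl⟩
  | tail _ hr ih =>
    obtain ⟨t', rfl, ht⟩ := ih
    cases hr with
    | inl hr => exact ⟨_, rfl, ht.tail hr⟩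

theorem Red.inr_inv {t s : PTerm} (h : Red (.inr t) s) : ∃ t', s = .inr t' ∧ Red t t' := by
  induction h with
  | refl => exact ⟨_, rfl, .refl⟩
  | tail _ hr ih =>
    obtain ⟨t', rfl, ht⟩ := ih
    cases hr with
    | inr hr => exact ⟨_, rfl, ht.tail hr⟩

theorem Red.pair_inv {t u s : PTerm} (h : Red (.pair t u) s) :
    ∃ t' u', s = .pair t' u' ∧ Red t t' ∧ Red u u' := by
  induction h with
  | refl => exact ⟨_, _, rfl, .refl, .refl⟩
  | tail _ hr ih =>
    obtain ⟨t', u', rfl, ht, hu⟩ := ih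
    cases hr with
    | pairL hr => exact ⟨_, _, rfl, ht.tail hr, hu⟩
    | pairR hr => exact ⟨_, _, rfl, ht, hu.tail hr⟩

/-- A neutral proof-term reduces to a non-neutral one in at least one step. -/
theorem Red.exists_step_of_neutral {t s : PTerm} (h : Red t s) (ht : Neutral t)
    (hs : ¬ Neutral s) : ∃ t', Red1 t t' ∧ Red t' s := by
  rcases Relation.ReflTransGen.cases_head h with rfl | h
  · exact absurd ht hs
  · exact h

theorem isCandidate_interp {M : ℕ → Set PTerm} (hM : IsPreModel M) (A : Form) :
    IsCandidate (interp M A) := by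
  cases A with
  | atom P => exact hM P
  | bot => exact ⟨fun _ h => h, fun _ h _ hr => SN.red h hr, fun _ _ h => ⟨_, h⟩⟩
  | imp A B =>
    refine ⟨fun _ h => h.1, fun _ h _ hr => ⟨h.1.red hr, fun _ hr' => h.2 _ (hr.trans hr')⟩,
      fun t ht h => ⟨⟨_, fun _ hr => (h _ hr).1⟩, fun _ hr => ?_⟩⟩
    obtain ⟨t', h₁, h₂⟩ := hr.exists_step_of_neutral ht id
    exact (h _ h₁).2 _ h₂
  | and A B =>
    refine ⟨fun _ h => h.1, fun _ h _ hr => ⟨h.1.red hr, fun _ _ hr' => h.2 _ _ (hr.trans hr')⟩,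
      fun t ht h => ⟨⟨_, fun _ hr => (h _ hr).1⟩, fun _ _ hr => ?_⟩⟩
    obtain ⟨t', h₁, h₂⟩ := hr.exists_step_of_neutral ht id
    exact (h _ h₁).2 _ _ h₂
  | or A B =>
    refine ⟨fun _ h => h.1, fun _ h _ hr => ⟨h.1.red hr, fun _ hr' => h.2.1 _ (hr.trans hr'),
        fun _ hr' => h.2.2 _ (hr.trans hr')⟩,
      fun t ht h => ⟨⟨_, fun _ hr => (h _ hr).1⟩, fun _ hr => ?_, fun _ hr => ?_⟩⟩
    · obtain ⟨t', h₁, h₂⟩ := hr.exists_step_of_neutral ht id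
      exact (h _ h₁).2.1 _ h₂
    · obtain ⟨t', h₁, h₂⟩ := hr.exists_step_of_neutral ht id
      exact (h _ h₁).2.2 _ h₂

theorem IsCandidate.step {S : Set PTerm} (hS : IsCandidate S) {t t' : PTerm} (ht : t ∈ S)
    (hr : Red1 t t') : t' ∈ S :=
  hS.closed _ ht _ (.single hr)

theorem IsCandidate.var_mem {S : Set PTerm} (hS : IsCandidate S) (n : ℕ) : .var n ∈ S :=
  hS.neutral _ trivial fun _ hr => nomatch hr

mutual

theorem Neg1.interp_subset {R : PRS} {M : ℕ → Set PTerm} (hM : IsPreModelOf R M) {A B : Form} :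
    Neg1 R A B → interp M A ⊆ interp M B
  | .rule h => hM.2.1 _ _ h
  | .impL h => fun _ ht => ⟨ht.1, fun _ hr _ hu => ht.2 _ hr _ (h.interp_subset hM hu)⟩
  | .impR h => fun _ ht => ⟨ht.1, fun _ hr _ hu => h.interp_subset hM (ht.2 _ hr _ hu)⟩
  | .andL h => fun _ ht =>
    ⟨ht.1, fun _ _ hr => ⟨h.interp_subset hM (ht.2 _ _ hr).1, (ht.2 _ _ hr).2⟩⟩
  | .andR h => fun _ ht =>
    ⟨ht.1, fun _ _ hr => ⟨(ht.2 _ _ hr).1, h.interp_subset hM (ht.2 _ _ hr).2⟩⟩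
  | .orL h => fun _ ht => ⟨ht.1, fun _ hr => h.interp_subset hM (ht.2.1 _ hr), ht.2.2⟩
  | .orR h => fun _ ht => ⟨ht.1, ht.2.1, fun _ hr => h.interp_subset hM (ht.2.2 _ hr)⟩

theorem Pos1.interp_subset {R : PRS} {M : ℕ → Set PTerm} (hM : IsPreModelOf R M) {A B : Form} :
    Pos1 R A B → interp M B ⊆ interp M A
  | .rule h => hM.2.2 _ _ h
  | .impL h => fun _ ht => ⟨ht.1, fun _ hr _ hu => ht.2 _ hr _ (h.interp_subset hM hu)⟩
  | .impR h => fun _ ht => ⟨ht.1, fun _ hr _ hu => h.interp_subset hM (ht.2 _ hr _ hu)⟩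
  | .andL h => fun _ ht =>
    ⟨ht.1, fun _ _ hr => ⟨h.interp_subset hM (ht.2 _ _ hr).1, (ht.2 _ _ hr).2⟩⟩
  | .andR h => fun _ ht =>
    ⟨ht.1, fun _ _ hr => ⟨(ht.2 _ _ hr).1, h.interp_subset hM (ht.2 _ _ hr).2⟩⟩
  | .orL h => fun _ ht => ⟨ht.1, fun _ hr => h.interp_subset hM (ht.2.1 _ hr), ht.2.2⟩
  | .orR h => fun _ ht => ⟨ht.1, ht.2.1, fun _ hr => h.interp_subset hM (ht.2.2 _ hr)⟩

end

theorem NegR.interp_subset {R : PRS} {M : ℕ → Set PTerm} (hM : IsPreModelOf R M) {A B : Form}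
    (h : NegR R A B) : interp M A ⊆ interp M B := by
  induction h with
  | refl => exact subset_rfl
  | tail _ h ih => exact ih.trans (h.interp_subset hM)

theorem PosR.interp_subset {R : PRS} {M : ℕ → Set PTerm} (hM : IsPreModelOf R M) {A B : Form}
    (h : PosR R A B) : interp M B ⊆ interp M A := by
  induction h with
  | refl => exact subset_rfl
  | tail _ h ih => exact (h.interp_subset hM).trans ih

section Reducibility

variable {M : ℕ → Set PTerm} {A B C : Form} {t u v : PTerm}

theorem sn_of_forall_subst_mem (hM : IsPreModel M)
    (h : ∀ w ∈ interp M A, subst 0 w t ∈ interp M B) :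
    SN t :=
  ((isCandidate_interp hM B).sn _ (h _ ((isCandidate_interp hM A).var_mem 0))).of_subst

theorem lam_mem_interp (hM : IsPreModel M) (h : ∀ w ∈ interp M A, subst 0 w t ∈ interp M B) :
    .lam t ∈ interp M (.imp A B) := by
  refine ⟨(sn_of_forall_subst_mem hM h).lam, fun t₁ hr w hw => ?_⟩
  obtain ⟨_, ⟨⟩, hr⟩ := hr.lam_inv
  exact (isCandidate_interp hM B).closed _ (h w hw) _ (hr.subst w)

theorem pair_mem_interp (hM : IsPreModel M) (ht : t ∈ interp M A) (hu : u ∈ interp M B) :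
    .pair t u ∈ interp M (.and A B) := by
  have hA := isCandidate_interp hM A
  have hB := isCandidate_interp hM B
  refine ⟨(hA.sn _ ht).pair (hB.sn _ hu), fun _ _ hr => ?_⟩
  obtain ⟨_, _, ⟨⟩, ht', hu'⟩ := hr.pair_inv
  exact ⟨hA.closed _ ht _ ht', hB.closed _ hu _ hu'⟩

theorem inl_mem_interp (hM : IsPreModel M) (ht : t ∈ interp M A) :
    .inl t ∈ interp M (.or A B) := by
  have hA := isCandidate_interp hM A
  refine ⟨(hA.sn _ ht).inl, fun _ hr => ?_, fun _ hr => ?_⟩ <;>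
    obtain ⟨_, ⟨⟩, hr⟩ := hr.inl_inv
  exact hA.closed _ ht _ hr

theorem inr_mem_interp (hM : IsPreModel M) (ht : t ∈ interp M B) :
    .inr t ∈ interp M (.or A B) := by
  have hB := isCandidate_interp hM B
  refine ⟨(hB.sn _ ht).inr, fun _ hr => ?_, fun _ hr => ?_⟩ <;>
    obtain ⟨_, ⟨⟩, hr⟩ := hr.inr_inv
  exact hB.closed _ ht _ hr

theorem app_mem_interp (hM : IsPreModel M) (ht : t ∈ interp M (.imp A B)) (hu : u ∈ interp M A) :
    .app t u ∈ interp M B := by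
  have hA := isCandidate_interp hM A
  have hAB := isCandidate_interp hM (.imp A B)
  have snt := hAB.sn _ ht
  have snu := hA.sn _ hu
  induction snt generalizing u with
  | intro t _ iht =>
    induction snu with
    | intro u snu ihu =>
      refine (isCandidate_interp hM B).neutral _ trivial fun _ hr => ?_
      cases hr with
      | beta => exact ht.2 _ .refl _ hu
      | appL hr => exact iht _ hr (hAB.step ht hr) hu ⟨_, snu⟩
      | appR hr => exact ihu _ hr (hA.step hu hr)

theorem fst_mem_interp (hM : IsPreModel M) (ht : t ∈ interp M (.and A B)) :
    .fst t ∈ interp M A := by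
  have hAB := isCandidate_interp hM (.and A B)
  have snt := hAB.sn _ ht
  induction snt with
  | intro t _ ih =>
    refine (isCandidate_interp hM A).neutral _ trivial fun _ hr => ?_
    cases hr with
    | fstPair => exact (ht.2 _ _ .refl).1
    | fst hr => exact ih _ hr (hAB.step ht hr)

theorem snd_mem_interp (hM : IsPreModel M) (ht : t ∈ interp M (.and A B)) :
    .snd t ∈ interp M B := by
  have hAB := isCandidate_interp hM (.and A B)
  have snt := hAB.sn _ ht
  induction snt with
  | intro t _ ih =>
    refine (isCandidate_interp hM B).neutral _ trivial fun _ hr => ?_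
    cases hr with
    | sndPair => exact (ht.2 _ _ .refl).2
    | snd hr => exact ih _ hr (hAB.step ht hr)

theorem exf_mem_interp (hM : IsPreModel M) (ht : SN t) : .exf t ∈ interp M A := by
  induction ht with
  | intro t _ ih =>
    refine (isCandidate_interp hM A).neutral _ trivial fun _ hr => ?_
    cases hr with
    | exf hr => exact ih _ hr

theorem case_mem_interp (hM : IsPreModel M) (ht : t ∈ interp M (.or A B))
    (hu : ∀ w ∈ interp M A, subst 0 w u ∈ interp M C)
    (hv : ∀ w ∈ interp M B, subst 0 w v ∈ interp M C) :
    .case t u v ∈ interp M C := by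
  have hC := isCandidate_interp hM C
  have hAB := isCandidate_interp hM (.or A B)
  have snt := hAB.sn _ ht
  have snu := sn_of_forall_subst_mem hM hu
  have snv := sn_of_forall_subst_mem hM hv
  induction snt generalizing u v with
  | intro t _ iht =>
    induction snu generalizing v with
    | intro u snu ihu =>
      induction snv with
      | intro v snv ihv =>
        refine hC.neutral _ trivial fun _ hr => ?_
        cases hr with
        | caseInl => exact hu _ (ht.2.1 _ .refl)
        | caseInr => exact hv _ (ht.2.2 _ .refl)
        | case₁ hr => exact iht _ hr (hAB.step ht hr) hu hv ⟨_, snu⟩ ⟨_, snv⟩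
        | case₂ hr => exact ihu _ hr (fun w hw => hC.step (hu w hw) (hr.subst w)) hv ⟨_, snv⟩
        | case₃ hr => exact ihv _ hr fun w hw => hC.step (hv w hw) (hr.subst w)

end Reducibility

theorem scons_mem_interp {M : ℕ → Set PTerm} {Γ : List Form} {σ : ℕ → PTerm}
    (hσ : ∀ n B, Γ[n]? = some B → σ n ∈ interp M B) {A : Form} {u : PTerm}
    (hu : u ∈ interp M A) (n : ℕ) (B : Form) (h : (A :: Γ)[n]? = some B) :
    scons u σ n ∈ interp M B := by
  cases n with
  | zero => cases h; exact hu
  | succ n => exact hσ n B (by simpa using h)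

/-- Adequacy: if →₋ and →₊ commute, M is a pre-model of R, π is a proof-term of
Γ ⊢_R A and σ maps each proof variable declared of type B in Γ to an element of
|B|, then σπ is an element of |A|. -/
theorem adequacy (R : PRS) (hcomm : Commutes R)
    (M : ℕ → Set PTerm) (hM : IsPreModelOf R M)
    (Γ : List Form) (π : PTerm) (A : Form)
    (h : Typed R Γ π A)
    (σ : ℕ → PTerm) (hσ : ∀ n B, Γ[n]? = some B → σ n ∈ interp M B) :
    msubst σ π ∈ interp M A := by
  induction h generalizing σ with
  | ax hn hA hB => exact hB.interp_subset hM (hA.interp_subset hM (hσ _ _ hn))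
  | impI _ hC ih =>
    refine hC.interp_subset hM (lam_mem_interp hM.1 fun w hw => ?_)
    rw [subst_zero_msubst_liftSub]
    exact ih _ (scons_mem_interp hσ hw)
  | impE _ hC _ ih₁ ih₂ =>
    exact app_mem_interp hM.1 (hC.interp_subset hM (ih₁ σ hσ)) (ih₂ σ hσ)
  | andI _ _ hC ih₁ ih₂ =>
    exact hC.interp_subset hM (pair_mem_interp hM.1 (ih₁ σ hσ) (ih₂ σ hσ))
  | andE₁ _ hC ih => exact fst_mem_interp hM.1 (hC.interp_subset hM (ih σ hσ))
  | andE₂ _ hC ih => exact snd_mem_interp hM.1 (hC.interp_subset hM (ih σ hσ))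
  | orI₁ _ hC ih => exact hC.interp_subset hM (inl_mem_interp hM.1 (ih σ hσ))
  | orI₂ _ hC ih => exact hC.interp_subset hM (inr_mem_interp hM.1 (ih σ hσ))
  | orE _ hD _ _ ih₁ ih₂ ih₃ =>
    refine case_mem_interp hM.1 (hD.interp_subset hM (ih₁ σ hσ)) (fun w hw => ?_) fun w hw => ?_ <;>
      rw [subst_zero_msubst_liftSub]
    · exact ih₂ _ (scons_mem_interp hσ hw)
    · exact ih₃ _ (scons_mem_interp hσ hw)
  | botE _ hB ih => exact exf_mem_interp hM.1 (hB.interp_subset hM (ih σ hσ))
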